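/- Let R ⊂ Z² be a finite set, let ℓ ≥ 2, let (α_x)_{x∈R} be i.i.d. standard real Gaussians, and define the field g' = (−Δ_R + ℓ^{-2}·Id)^{-1} α ∈ R^R, extended by g'_y = 0 for y ∉ R. Define the local mass m_x² = Σ_{y: ‖y−x‖₁=1} (g'_y − g'_x)². Then there is a universal constant C > 0 such that E[ Σ_{x∈R} m_x² ] ≤ C |R| (1 + log ℓ). (With ℓ of order ε^{-1}, this shows the masses m_x appearing in the renormalized Hamiltonian K(φ) = Σ_{⟨xy⟩}[cos(φ_x−φ_y)−1] + ½Σ_x m_x² cos²(φ_x) are typically of order ε₂ = ε√|log ε| in two dimensions.) -/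

import Mathlib

open scoped Classical BigOperators
open MeasureTheory

noncomputable section

/-- A site of the lattice `ℤ²`. -/
abbrev Site2 := Fin 2 → ℤ

/-- The ℓ¹ distance on `ℤ²`; nearest neighbors are at ℓ¹ distance 1. -/
def l1dist (x y : Site2) : ℤ := ∑ i, |x i - y i|

/-- The Dirichlet Laplacian `−Δ_R` of a finite region `R ⊂ ℤ²`:
`(−Δ_R f)(x) = 4·f(x) − Σ_{y∈R, ‖y−x‖₁=1} f(y)`. -/
def dirLap (R : Finset Site2) : Matrix R R ℝ := fun x y =>
  if (x : Site2) = (y : Site2) then (4 : ℝ)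
  else if l1dist (x : Site2) (y : Site2) = 1 then -1 else 0

/-- The field `g' = (−Δ_R + ℓ^{-2}·Id)^{-1} α`, extended by `0` outside `R`. -/
def massiveField (R : Finset Site2) (ℓ : ℕ) (α : R → ℝ) (y : Site2) : ℝ :=
  if h : y ∈ R then
    Matrix.mulVec (dirLap R + ((ℓ : ℝ) ^ 2)⁻¹ • (1 : Matrix R R ℝ))⁻¹ α ⟨y, h⟩
  else 0

/-- The local mass `m_x² = Σ_{y : ‖y−x‖₁=1} (g'_y − g'_x)²`, the sum running over the four
nearest neighbors `y = x ± eᵢ` of `x` in `ℤ²`. -/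
def localMassSq (R : Finset Site2) (ℓ : ℕ) (α : R → ℝ) (x : Site2) : ℝ :=
  ∑ i : Fin 2,
    ((massiveField R ℓ α (x + Pi.single i 1) - massiveField R ℓ α x) ^ 2 +
      (massiveField R ℓ α (x - Pi.single i 1) - massiveField R ℓ α x) ^ 2)

/-- The i.i.d. standard Gaussian disorder distribution on `ℝ^R`. -/
def disorderP (R : Finset Site2) : Measure (R → ℝ) :=
  Measure.pi fun _ => ProbabilityTheory.gaussianReal 0 1

/-- The number of `n`-step nearest-neighbor paths in `ℤ` from `0` to `k`. -/
def linePathCount : ℕ → ℤ → ℝ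
  | 0, k => if k = 0 then 1 else 0
  | n + 1, k => linePathCount n (k - 1) + linePathCount n (k + 1)

/-- The number of `n`-step nearest-neighbor paths in `ℤ²` from `0` to `z`: in the rotated
coordinates `z 0 ± z 1` the two components move independently. -/
def planePathCount (n : ℕ) (z : Site2) : ℝ :=
  linePathCount n (z 0 + z 1) * linePathCount n (z 0 - z 1)

/-- The sum of a function over the four nearest neighbors of a site. -/
def neighborSum (h : Site2 → ℝ) (x : Site2) : ℝ :=
  ∑ i : Fin 2, (h (x + Pi.single i 1) + h (x - Pi.single i 1))

/-- The extension by zero of a function on a finite region. -/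
def zeroExtend (R : Finset Site2) (v : R → ℝ) (y : Site2) : ℝ :=
  if h : y ∈ R then v ⟨y, h⟩ else 0

/-- The adjacency matrix of a finite region. -/
def regionAdj (R : Finset Site2) : Matrix R R ℝ := fun x y =>
  neighborSum (fun z => if z = y then 1 else 0) x

lemma linePathCount_nonneg (n : ℕ) (k : ℤ) : 0 ≤ linePathCount n k := by
  induction n generalizing k with
  | zero => simp only [linePathCount]; split_ifs <;> norm_num
  | succ n ih => exact add_nonneg (ih _) (ih _)

lemma linePathCount_le (n : ℕ) (k : ℤ) : linePathCount n k ≤ 2 ^ n := by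
  induction n generalizing k with
  | zero => simp only [linePathCount]; split_ifs <;> norm_num
  | succ n ih =>
    have h₁ := ih (k - 1)
    have h₂ := ih (k + 1)
    simp only [linePathCount, pow_succ]
    linarith

lemma linePathCount_of_lt (n : ℕ) (k : ℤ) (hk : k < -n) : linePathCount n k = 0 := by
  induction n generalizing k with
  | zero => simp only [linePathCount]; rw [if_neg]; push_cast at hk; omega
  | succ n ih =>
    push_cast at hk
    simp only [linePathCount]
    rw [ih _ (by omega), ih _ (by omega), add_zero]

lemma linePathCount_of_odd (n : ℕ) (k : ℤ) (hk : Odd (n + k)) : linePathCount n k = 0 := by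
  induction n generalizing k with
  | zero =>
    simp only [linePathCount]
    rw [if_neg]
    rintro rfl
    simp at hk
  | succ n ih =>
    simp only [linePathCount]
    rw [ih, ih, add_zero]
    · push_cast at hk
      convert hk using 1
      ring
    · obtain ⟨m, hm⟩ := hk
      push_cast at hm
      exact ⟨m - 1, by linarith⟩

lemma linePathCount_eq_choose (n j : ℕ) : linePathCount n (2 * j - n) = n.choose j := by
  induction n generalizing j with
  | zero =>
    cases j with
    | zero => simp [linePathCount]
    | succ j =>
      simp only [linePathCount]
      rw [if_neg (by push_cast; omega)]
      simp
  | succ n ih =>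
    simp only [linePathCount]
    cases j with
    | zero =>
      have h := ih 0
      rw [linePathCount_of_lt _ _ (by push_cast; omega)]
      simp only [Nat.choose_zero_right, Nat.cast_one] at h ⊢
      rw [zero_add, ← h]
      congr 1
      push_cast
      ring
    | succ j =>
      rw [Nat.choose_succ_succ, Nat.cast_add (n.choose j), ← ih, ← ih]
      congr 2 <;> push_cast <;> ring

lemma centralBinom_sq_mul_le (k : ℕ) : (k.centralBinom : ℝ) ^ 2 * (2 * k + 1) ≤ 16 ^ k := by
  induction k with
  | zero => simp
  | succ k ih =>
    have h : ((k : ℝ) + 1) * ((k + 1).centralBinom : ℝ) = 2 * (2 * k + 1) * k.centralBinom := by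
      exact_mod_cast Nat.succ_mul_centralBinom_succ k
    have hk : (0 : ℝ) < (k + 1) ^ 2 := by positivity
    refine le_of_mul_le_mul_left ?_ hk
    calc ((k : ℝ) + 1) ^ 2 * (((k + 1).centralBinom : ℝ) ^ 2 * (2 * ((k + 1 : ℕ) : ℝ) + 1))
        = (((k : ℝ) + 1) * ((k + 1).centralBinom : ℝ)) ^ 2 * (2 * k + 3) := by
          push_cast; ring
      _ = 4 * ((2 * k + 1) * (2 * k + 3)) * ((k.centralBinom : ℝ) ^ 2 * (2 * k + 1)) := by
          rw [h]; ring
      _ ≤ 4 * ((2 * k + 1) * (2 * k + 3)) * 16 ^ k := by gcongr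
      _ ≤ 16 * (k + 1) ^ 2 * 16 ^ k := by
          refine mul_le_mul_of_nonneg_right ?_ (by positivity)
          nlinarith
      _ = ((k : ℝ) + 1) ^ 2 * 16 ^ (k + 1) := by ring

lemma planePathCount_zero_le (n : ℕ) : planePathCount n 0 ≤ 4 ^ n / (n + 1) := by
  simp only [planePathCount, Pi.zero_apply, add_zero, sub_zero]
  obtain ⟨k, rfl | rfl⟩ := Nat.even_or_odd' n
  · have h := linePathCount_eq_choose (2 * k) k
    rw [← Nat.centralBinom_eq_two_mul_choose] at h
    push_cast at h
    rw [sub_self] at h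
    rw [h, le_div_iff₀ (by positivity), pow_mul]
    have := centralBinom_sq_mul_le k
    norm_num
    linarith
  · rw [linePathCount_of_odd _ _ (by push_cast; exact ⟨k, by ring⟩), zero_mul]
    positivity

lemma planePathCount_nonneg (n : ℕ) (z : Site2) : 0 ≤ planePathCount n z :=
  mul_nonneg (linePathCount_nonneg _ _) (linePathCount_nonneg _ _)

lemma planePathCount_le (n : ℕ) (z : Site2) : planePathCount n z ≤ 4 ^ n := by
  calc planePathCount n z ≤ 2 ^ n * 2 ^ n :=
        mul_le_mul (linePathCount_le _ _) (linePathCount_le _ _) (linePathCount_nonneg _ _)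
          (by positivity)
    _ = 4 ^ n := by rw [← mul_pow]; norm_num

lemma neighborSum_planePathCount (n : ℕ) (x y : Site2) :
    neighborSum (fun z => planePathCount n (z - y)) x = planePathCount (n + 1) (x - y) := by
  simp only [neighborSum, planePathCount, linePathCount, Fin.sum_univ_two, Pi.sub_apply,
    Pi.add_apply, Pi.single_apply]
  norm_num
  ring_nf

lemma neighborSum_mono {h k : Site2 → ℝ} (hk : ∀ z, h z ≤ k z) (x : Site2) :
    neighborSum h x ≤ neighborSum k x :=
  Finset.sum_le_sum fun _ _ => add_le_add (hk _) (hk _)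

lemma zeroExtend_coe (R : Finset Site2) (v : R → ℝ) (x : R) : zeroExtend R v x = v x := by
  simp [zeroExtend]

lemma sum_ite_mul_eq_zeroExtend (R : Finset Site2) (v : R → ℝ) (z : Site2) :
    ∑ y : R, (if z = (y : Site2) then (1 : ℝ) else 0) * v y = zeroExtend R v z := by
  unfold zeroExtend
  split_ifs with h
  · rw [Finset.sum_eq_single ⟨z, h⟩]
    · simp
    · intro b _ hb
      rw [if_neg, zero_mul]
      rintro rfl
      exact hb rfl
    · simp
  · refine Finset.sum_eq_zero fun y _ => ?_
    rw [if_neg, zero_mul]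
    rintro rfl
    exact h y.2

lemma regionAdj_mulVec (R : Finset Site2) (v : R → ℝ) (x : R) :
    (regionAdj R).mulVec v x = neighborSum (zeroExtend R v) x := by
  simp only [Matrix.mulVec, dotProduct, regionAdj, neighborSum, Finset.sum_mul, add_mul]
  rw [Finset.sum_comm]
  simp only [Finset.sum_add_distrib, sum_ite_mul_eq_zeroExtend]

lemma dirLap_eq (R : Finset Site2) : dirLap R = (4 : ℝ) • (1 : Matrix R R ℝ) - regionAdj R := by
  ext x y
  obtain ⟨x, hx⟩ := x
  obtain ⟨y, hy⟩ := y
  simp only [dirLap, l1dist, regionAdj, neighborSum, Fin.sum_univ_two, Matrix.sub_apply,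
    Matrix.smul_apply, Matrix.one_apply, Subtype.mk.injEq, funext_iff, Fin.forall_fin_two,
    Pi.add_apply, Pi.sub_apply, Pi.single_apply]
  generalize x 0 = a
  generalize x 1 = b
  generalize y 0 = c
  generalize y 1 = d
  simp only [abs_eq_max_neg]
  norm_num
  split_ifs <;> first | omega | norm_num

lemma regionAdj_nonneg (R : Finset Site2) (x y : R) : 0 ≤ regionAdj R x y := by
  unfold regionAdj neighborSum
  positivity

lemma regionAdj_pow_nonneg (R : Finset Site2) (n : ℕ) (x y : R) :
    0 ≤ (regionAdj R ^ n) x y := by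
  induction n generalizing x with
  | zero => rw [pow_zero, Matrix.one_apply]; split_ifs <;> norm_num
  | succ n ih =>
    rw [pow_succ', Matrix.mul_apply]
    exact Finset.sum_nonneg fun w _ => mul_nonneg (regionAdj_nonneg R x w) (ih w)

lemma regionAdj_pow_le (R : Finset Site2) (n : ℕ) (x y : R) :
    (regionAdj R ^ n) x y ≤ planePathCount n (x - y) := by
  induction n generalizing x with
  | zero =>
    rw [pow_zero, Matrix.one_apply]
    split_ifs with h
    · subst h
      simp [planePathCount, linePathCount]
    · exact planePathCount_nonneg _ _
  | succ n ih =>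
    have key : (regionAdj R ^ (n + 1)) x y =
        (regionAdj R).mulVec (fun w => (regionAdj R ^ n) w y) x := by
      rw [pow_succ', Matrix.mul_apply]; rfl
    rw [key, regionAdj_mulVec, ← neighborSum_planePathCount]
    refine neighborSum_mono (fun z => ?_) x
    unfold zeroExtend
    split_ifs with h
    · exact ih ⟨z, h⟩
    · exact planePathCount_nonneg _ _

lemma sum_shift_sq_le (R : Finset Site2) (v : R → ℝ) (e : Site2) :
    ∑ x ∈ R, zeroExtend R v (x + e) ^ 2 ≤ ∑ x ∈ R, zeroExtend R v x ^ 2 := by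
  calc ∑ x ∈ R, zeroExtend R v (x + e) ^ 2
      = ∑ y ∈ R.map (addRightEmbedding e), zeroExtend R v y ^ 2 := by
        rw [Finset.sum_map]; rfl
    _ ≤ ∑ y ∈ R.map (addRightEmbedding e) ∪ R, zeroExtend R v y ^ 2 :=
        Finset.sum_le_sum_of_subset_of_nonneg Finset.subset_union_left
          fun _ _ _ => sq_nonneg _
    _ = ∑ x ∈ R, zeroExtend R v x ^ 2 := by
        symm
        refine Finset.sum_subset Finset.subset_union_right fun y _ hy => ?_
        simp [zeroExtend, hy]

/-- The Dirichlet energy controls the sum of the squared gradients at the sites of the region. -/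
lemma sum_gradSq_le_dirLap (R : Finset Site2) (v : R → ℝ) :
    ∑ x ∈ R, ∑ i : Fin 2,
        ((zeroExtend R v (x + Pi.single i 1) - zeroExtend R v x) ^ 2 +
          (zeroExtend R v (x - Pi.single i 1) - zeroExtend R v x) ^ 2) ≤
      2 * ∑ x : R, v x * (dirLap R).mulVec v x := by
  have hL : ∑ x : R, v x * (dirLap R).mulVec v x =
      ∑ x ∈ R, zeroExtend R v x * (4 * zeroExtend R v x - neighborSum (zeroExtend R v) x) := by
    rw [← Finset.sum_coe_sort R]
    refine Finset.sum_congr rfl fun x _ => ?_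
    rw [dirLap_eq, Matrix.sub_mulVec, Pi.sub_apply, regionAdj_mulVec, zeroExtend_coe,
      Matrix.smul_mulVec, Matrix.one_mulVec, Pi.smul_apply, smul_eq_mul]
  have hs : ∀ i : Fin 2,
      ∑ x ∈ R, (zeroExtend R v (x + Pi.single i 1) ^ 2 +
        zeroExtend R v (x - Pi.single i 1) ^ 2) ≤ 2 * ∑ x ∈ R, zeroExtend R v x ^ 2 := by
    intro i
    rw [Finset.sum_add_distrib, two_mul]
    refine add_le_add (sum_shift_sq_le R v _) ?_
    simpa only [sub_eq_add_neg] using sum_shift_sq_le R v (-Pi.single i 1)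
  have h₀ := hs 0
  have h₁ := hs 1
  rw [hL]
  simp only [neighborSum, Fin.sum_univ_two]
  have hexp : ∀ x : Site2,
      (zeroExtend R v (x + Pi.single 0 1) - zeroExtend R v x) ^ 2 +
          (zeroExtend R v (x - Pi.single 0 1) - zeroExtend R v x) ^ 2 +
        ((zeroExtend R v (x + Pi.single 1 1) - zeroExtend R v x) ^ 2 +
          (zeroExtend R v (x - Pi.single 1 1) - zeroExtend R v x) ^ 2) =
      (zeroExtend R v (x + Pi.single 0 1) ^ 2 + zeroExtend R v (x - Pi.single 0 1) ^ 2) +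
        (zeroExtend R v (x + Pi.single 1 1) ^ 2 + zeroExtend R v (x - Pi.single 1 1) ^ 2) -
        4 * zeroExtend R v x ^ 2 +
        2 * (zeroExtend R v x * (4 * zeroExtend R v x -
          (zeroExtend R v (x + Pi.single 0 1) + zeroExtend R v (x - Pi.single 0 1) +
            (zeroExtend R v (x + Pi.single 1 1) + zeroExtend R v (x - Pi.single 1 1))))) := by
    intro x; ring
  simp only [hexp]
  rw [Finset.sum_add_distrib, Finset.sum_sub_distrib, Finset.sum_add_distrib, ← Finset.mul_sum,
    ← Finset.mul_sum]
  linarith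

lemma dirLap_nonneg (R : Finset Site2) (v : R → ℝ) :
    0 ≤ ∑ x : R, v x * (dirLap R).mulVec v x := by
  have h := sum_gradSq_le_dirLap R v
  have h' : 0 ≤ ∑ x ∈ R, ∑ i : Fin 2,
        ((zeroExtend R v (x + Pi.single i 1) - zeroExtend R v x) ^ 2 +
          (zeroExtend R v (x - Pi.single i 1) - zeroExtend R v x) ^ 2) := by positivity
  linarith

lemma isUnit_det_dirLap_add (R : Finset Site2) {s : ℝ} (hs : 0 < s) :
    IsUnit (dirLap R + s • (1 : Matrix R R ℝ)).det := by
  rw [isUnit_iff_ne_zero]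
  intro h
  obtain ⟨v, hv, hv0⟩ := Matrix.exists_mulVec_eq_zero_iff.mpr h
  refine hv (funext fun x => ?_)
  have hsum : ∑ x : R, v x * (dirLap R).mulVec v x + s * ∑ x : R, v x ^ 2 = 0 := by
    rw [Finset.mul_sum, ← Finset.sum_add_distrib]
    refine Finset.sum_eq_zero fun x _ => ?_
    have := congrFun hv0 x
    rw [Matrix.add_mulVec, Matrix.smul_mulVec, Matrix.one_mulVec, Pi.add_apply,
      Pi.smul_apply, smul_eq_mul, Pi.zero_apply] at this
    linear_combination v x * this
  have h₁ := dirLap_nonneg R v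
  have h₂ : v x ^ 2 ≤ ∑ x : R, v x ^ 2 :=
    Finset.single_le_sum (f := fun x => v x ^ 2) (fun _ _ => sq_nonneg _) (Finset.mem_univ x)
  have h₃ : v x ^ 2 ≤ 0 := by
    by_contra! hpos
    nlinarith
  exact pow_eq_zero_iff two_ne_zero |>.mp (le_antisymm h₃ (sq_nonneg _))

lemma sum_pow_div_le (ℓ : ℕ) (hℓ : 1 ≤ ℓ) {r : ℝ} (h₀ : 0 ≤ r) (h₁ : r < 1) (M : ℕ) :
    ∑ n ∈ Finset.range M, r ^ n / ((n : ℝ) + 1) ≤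
      1 + 2 * Real.log ℓ + ((ℓ : ℝ) ^ 2)⁻¹ * (1 - r)⁻¹ := by
  have hpt : ∀ n : ℕ, r ^ n / ((n : ℝ) + 1) ≤
      (if n < ℓ ^ 2 then ((n : ℝ) + 1)⁻¹ else 0) + ((ℓ : ℝ) ^ 2)⁻¹ * r ^ n := by
    intro n
    split_ifs with h
    · have h₂ : r ^ n / ((n : ℝ) + 1) ≤ ((n : ℝ) + 1)⁻¹ := by
        rw [div_eq_mul_inv]
        exact mul_le_of_le_one_left (by positivity) (pow_le_one₀ h₀ h₁.le)
      have : 0 ≤ ((ℓ : ℝ) ^ 2)⁻¹ * r ^ n := by positivity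
      linarith
    · rw [zero_add, div_eq_inv_mul]
      have h₂ : (ℓ : ℝ) ^ 2 ≤ n + 1 := by
        have : ℓ ^ 2 ≤ n + 1 := by omega
        exact_mod_cast this
      have h₃ : (0 : ℝ) < (ℓ : ℝ) ^ 2 := by positivity
      gcongr
  refine (Finset.sum_le_sum fun n _ => hpt n).trans ?_
  rw [Finset.sum_add_distrib, ← Finset.mul_sum]
  have hgeom : ∑ n ∈ Finset.range M, r ^ n ≤ (1 - r)⁻¹ := by
    rw [← tsum_geometric_of_lt_one h₀ h₁]
    exact (summable_geometric_of_lt_one h₀ h₁).sum_le_tsum _ fun _ _ => by positivity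
  have hharm : ∑ n ∈ Finset.range M, (if n < ℓ ^ 2 then ((n : ℝ) + 1)⁻¹ else 0) ≤
      1 + 2 * Real.log ℓ := by
    rw [← Finset.sum_filter]
    calc ∑ n ∈ (Finset.range M).filter (· < ℓ ^ 2), ((n : ℝ) + 1)⁻¹
        ≤ ∑ n ∈ Finset.range (ℓ ^ 2), ((n : ℝ) + 1)⁻¹ := by
          refine Finset.sum_le_sum_of_subset_of_nonneg (fun n hn => ?_) fun _ _ _ => by positivity
          simpa using (Finset.mem_filter.mp hn).2
      _ = (harmonic (ℓ ^ 2) : ℝ) := by simp [harmonic]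
      _ ≤ 1 + Real.log ((ℓ ^ 2 : ℕ) : ℝ) := harmonic_le_one_add_log _
      _ = 1 + 2 * Real.log ℓ := by rw [Nat.cast_pow, Real.log_pow]; norm_num
  gcongr

/-- Truncated Neumann expansion of the massive Green function. -/
lemma smul_inv_eq_geom_sum (R : Finset Site2) {s : ℝ} (hs : 0 < s) (M : ℕ) :
    (4 + s) • (dirLap R + s • (1 : Matrix R R ℝ))⁻¹ =
      ∑ n ∈ Finset.range M, ((4 + s)⁻¹ • regionAdj R) ^ n +
        (4 + s) • ((dirLap R + s • (1 : Matrix R R ℝ))⁻¹ * ((4 + s)⁻¹ • regionAdj R) ^ M) := by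
  have hD : 4 + s ≠ 0 := by positivity
  set P := (4 + s)⁻¹ • regionAdj R with hP
  set A := dirLap R + s • (1 : Matrix R R ℝ) with hA
  have hAP : A = (4 + s) • (1 - P) := by
    rw [hA, hP, dirLap_eq, smul_sub, smul_smul, mul_inv_cancel₀ hD, one_smul, add_smul]
    abel
  have hinv : A⁻¹ * A = 1 := Matrix.nonsing_inv_mul _ (isUnit_det_dirLap_add R hs)
  have hgeom := mul_neg_geom_sum P M
  have h : (4 + s) • (A⁻¹ * (1 - P ^ M)) = ∑ n ∈ Finset.range M, P ^ n := by
    rw [← hgeom, ← Matrix.mul_assoc, ← Matrix.smul_mul, ← Matrix.mul_smul, ← hAP, hinv,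
      Matrix.one_mul]
  rw [← h, ← smul_add, ← Matrix.mul_add, sub_add_cancel, Matrix.mul_one]

/-- The massive Green function on the diagonal is at most logarithmic in the inverse mass,
uniformly in the region. -/
lemma inv_dirLap_diag_le (R : Finset Site2) (ℓ : ℕ) (hℓ : 1 ≤ ℓ) (x : R) :
    (dirLap R + ((ℓ : ℝ) ^ 2)⁻¹ • (1 : Matrix R R ℝ))⁻¹ x x ≤ 2 * (1 + Real.log ℓ) := by
  set s : ℝ := ((ℓ : ℝ) ^ 2)⁻¹ with hs_def
  have hℓ' : (1 : ℝ) ≤ ℓ := by exact_mod_cast hℓ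
  have hs : 0 < s := by positivity
  have hD : 0 < 4 + s := by positivity
  set G := (dirLap R + s • (1 : Matrix R R ℝ))⁻¹ with hG
  set r : ℝ := 4 / (4 + s) with hr
  have hr0 : 0 ≤ r := by positivity
  have hr1 : r < 1 := by rw [hr, div_lt_one hD]; linarith
  have hpow : ∀ n : ℕ, ((4 + s)⁻¹ • regionAdj R) ^ n = ((4 + s)⁻¹) ^ n • regionAdj R ^ n :=
    fun n => smul_pow _ _ _
  have hPle : ∀ (n : ℕ) (y z : R), (((4 + s)⁻¹ • regionAdj R) ^ n) y z ≤ r ^ n := by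
    intro n y z
    rw [hpow, Matrix.smul_apply, smul_eq_mul, hr, div_eq_inv_mul, mul_pow]
    gcongr
    exact (regionAdj_pow_le R n y z).trans (planePathCount_le _ _)
  have hPdiag : ∀ n : ℕ, (((4 + s)⁻¹ • regionAdj R) ^ n) x x ≤ r ^ n / ((n : ℝ) + 1) := by
    intro n
    rw [hpow, Matrix.smul_apply, smul_eq_mul, hr, div_eq_inv_mul 4, mul_pow, mul_div_assoc]
    gcongr
    have h := regionAdj_pow_le R n x x
    rw [sub_self] at h
    exact h.trans (planePathCount_zero_le n)
  have hPnonneg : ∀ (n : ℕ) (y z : R), 0 ≤ (((4 + s)⁻¹ • regionAdj R) ^ n) y z := by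
    intro n y z
    rw [hpow, Matrix.smul_apply, smul_eq_mul]
    exact mul_nonneg (by positivity) (regionAdj_pow_nonneg R n y z)
  have hbound : ∀ M : ℕ, (4 + s) * G x x ≤
      1 + 2 * Real.log ℓ + s * (1 - r)⁻¹ + (4 + s) * ∑ y : R, |G x y| * r ^ M := by
    intro M
    have h := congrFun (congrFun (smul_inv_eq_geom_sum R hs M) x) x
    rw [Matrix.smul_apply, smul_eq_mul, Matrix.add_apply, Matrix.sum_apply, Matrix.smul_apply,
      smul_eq_mul, Matrix.mul_apply] at h
    rw [h]
    gcongr with y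
    · exact (Finset.sum_le_sum fun n _ => hPdiag n).trans (sum_pow_div_le ℓ hℓ hr0 hr1 M)
    · exact hPnonneg M y x
    · exact le_abs_self _
    · exact hPle M y x
  have hlim : Filter.Tendsto (fun M : ℕ => 1 + 2 * Real.log ℓ + s * (1 - r)⁻¹ +
      (4 + s) * ∑ y : R, |G x y| * r ^ M) Filter.atTop
      (nhds (1 + 2 * Real.log ℓ + s * (1 - r)⁻¹ + (4 + s) * ∑ y : R, |G x y| * 0)) :=
    ((tendsto_finsetSum _ fun y _ =>
      (tendsto_pow_atTop_nhds_zero_of_lt_one hr0 hr1).const_mul _).const_mul _).const_add _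
  have hfin := ge_of_tendsto' hlim hbound
  have hsr : s * (1 - r)⁻¹ = 4 + s := by
    rw [hr]
    field_simp
    ring_nf
    field_simp
  have hlog : 0 ≤ Real.log ℓ := Real.log_nonneg hℓ'
  simp only [mul_zero, Finset.sum_const_zero, add_zero, hsr] at hfin
  by_contra! hlt
  nlinarith [mul_lt_mul_of_pos_left hlt hD, mul_nonneg hs.le hlog]

lemma memLp_eval_disorderP (R : Finset Site2) (x : R) :
    MemLp (fun α : R → ℝ => α x) 2 (disorderP R) :=
  (ProbabilityTheory.memLp_id_gaussianReal' (μ := 0) (v := 1) 2 (by simp)).comp_measurePreserving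
    (measurePreserving_eval (fun _ : R => ProbabilityTheory.gaussianReal 0 1) x)

lemma integrable_eval_mul_eval (R : Finset Site2) (x y : R) :
    Integrable (fun α : R → ℝ => α x * α y) (disorderP R) :=
  (memLp_eval_disorderP R x).integrable_mul (memLp_eval_disorderP R y)

lemma integral_eval_mul_eval (R : Finset Site2) (x y : R) :
    ∫ α : R → ℝ, α x * α y ∂(disorderP R) = if x = y then 1 else 0 := by
  have hmean : ∀ z : R, ∫ α : R → ℝ, α z ∂(disorderP R) = 0 := fun z => by
    have := integral_comp_eval (μ := fun _ : R => ProbabilityTheory.gaussianReal 0 1) (i := z)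
      (f := fun t : ℝ => t) aestronglyMeasurable_id
    exact this.trans ProbabilityTheory.integral_id_gaussianReal
  split_ifs with h
  · subst h
    have h₁ := integral_comp_eval (μ := fun _ : R => ProbabilityTheory.gaussianReal 0 1) (i := x)
      (f := fun t : ℝ => t * t) (by fun_prop)
    have h₂ := ProbabilityTheory.variance_of_integral_eq_zero
      (μ := ProbabilityTheory.gaussianReal 0 1) (X := id) aemeasurable_id
      ProbabilityTheory.integral_id_gaussianReal
    rw [ProbabilityTheory.variance_id_gaussianReal] at h₂
    refine h₁.trans ?_
    simpa [pow_two] using h₂.symm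
  · have hind := ProbabilityTheory.iIndepFun_pi
      (μ := fun _ : R => ProbabilityTheory.gaussianReal 0 1) (X := fun _ => id)
      fun _ => aemeasurable_id
    have := (hind.indepFun h).integral_fun_mul_eq_mul_integral
      (memLp_eval_disorderP R x).aestronglyMeasurable
      (memLp_eval_disorderP R y).aestronglyMeasurable
    refine this.trans ?_
    exact mul_eq_zero_of_left (hmean x) _

lemma integrable_quadratic (R : Finset Site2) (G : Matrix R R ℝ) :
    Integrable (fun α : R → ℝ => ∑ x, G.mulVec α x * α x) (disorderP R) := by
  refine integrable_finsetSum _ fun x _ => ?_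
  simp only [Matrix.mulVec, dotProduct, Finset.sum_mul, mul_assoc]
  exact integrable_finsetSum _ fun y _ => (integrable_eval_mul_eval R y x).const_mul _

lemma integral_quadratic (R : Finset Site2) (G : Matrix R R ℝ) :
    ∫ α : R → ℝ, ∑ x, G.mulVec α x * α x ∂(disorderP R) = G.trace := by
  have hint : ∀ x y : R, Integrable (fun α : R → ℝ => G x y * (α y * α x)) (disorderP R) :=
    fun x y => (integrable_eval_mul_eval R y x).const_mul _
  simp only [Matrix.mulVec, dotProduct, Finset.sum_mul, mul_assoc]
  rw [integral_finsetSum _ fun x _ => integrable_finsetSum _ fun y _ => hint x y]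
  refine Finset.sum_congr rfl fun x _ => ?_
  rw [integral_finsetSum _ fun y _ => hint x y]
  simp [integral_const_mul, integral_eval_mul_eval]

lemma sum_localMassSq_le (R : Finset Site2) (ℓ : ℕ) (hℓ : 1 ≤ ℓ) (α : R → ℝ) :
    ∑ x ∈ R, localMassSq R ℓ α x ≤
      2 * ∑ x, (dirLap R + ((ℓ : ℝ) ^ 2)⁻¹ • (1 : Matrix R R ℝ))⁻¹.mulVec α x * α x := by
  have hs : 0 < ((ℓ : ℝ) ^ 2)⁻¹ := by positivity
  set s : ℝ := ((ℓ : ℝ) ^ 2)⁻¹ with hs_def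
  set v := (dirLap R + s • (1 : Matrix R R ℝ))⁻¹.mulVec α with hv
  refine (sum_gradSq_le_dirLap R v).trans ?_
  have hα : (dirLap R + s • (1 : Matrix R R ℝ)).mulVec v = α := by
    rw [hv, Matrix.mulVec_mulVec, Matrix.mul_nonsing_inv _ (isUnit_det_dirLap_add R hs),
      Matrix.one_mulVec]
  gcongr 2 * ∑ x, ?_ with x
  have hx := congrFun hα x
  rw [Matrix.add_mulVec, Matrix.smul_mulVec, Matrix.one_mulVec, Pi.add_apply,
    Pi.smul_apply, smul_eq_mul] at hx
  rw [← hx]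
  nlinarith [mul_nonneg hs.le (sq_nonneg (v x))]

/-- There is a universal constant `C > 0` such that for every finite
`R ⊂ ℤ²` and every `ℓ ≥ 2`, with `g' = (−Δ_R + ℓ^{-2}·Id)^{-1}α` (extended by zero off `R`)
and `m_x² = Σ_{‖y−x‖₁=1}(g'_y − g'_x)²`, one has `E[Σ_{x∈R} m_x²] ≤ C |R| (1 + log ℓ)`. -/
theorem expected_total_mass_bound :
    ∃ C : ℝ, 0 < C ∧ ∀ (R : Finset Site2) (ℓ : ℕ), 2 ≤ ℓ →
      (∫ α, (∑ x ∈ R, localMassSq R ℓ α x) ∂(disorderP R)) ≤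
        C * (R.card : ℝ) * (1 + Real.log ℓ) := by
  refine ⟨4, by norm_num, fun R ℓ hℓ => ?_⟩
  have hℓ' : 1 ≤ ℓ := by omega
  set G := (dirLap R + ((ℓ : ℝ) ^ 2)⁻¹ • (1 : Matrix R R ℝ))⁻¹ with hG
  calc (∫ α, (∑ x ∈ R, localMassSq R ℓ α x) ∂(disorderP R))
      ≤ ∫ α, 2 * ∑ x, G.mulVec α x * α x ∂(disorderP R) := by
        refine integral_mono_of_nonneg (Filter.Eventually.of_forall fun α => ?_)
          ((integrable_quadratic R G).const_mul 2)
          (Filter.Eventually.of_forall (sum_localMassSq_le R ℓ hℓ'))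
        refine Finset.sum_nonneg fun x _ => Finset.sum_nonneg fun i _ => ?_
        positivity
    _ = 2 * ∑ x : R, G x x := by
        rw [integral_const_mul, integral_quadratic]
        rfl
    _ ≤ 2 * ∑ _x : R, 2 * (1 + Real.log ℓ) := by
        gcongr with x
        exact inv_dirLap_diag_le R ℓ hℓ' x
    _ = 4 * (R.card : ℝ) * (1 + Real.log ℓ) := by
        simp
        ring

end
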